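/- Let 0 < a ≤ 1 and fix σ ∈ ℝ. Then for t ≥ 2 the following bounds hold as t → ∞, with implied constants depending only on a and σ: (i) if σ > 1 then ζ_H(σ+it, a) ≪ 1; (ii) if 0 ≤ σ ≤ 1 then ζ_H(σ+it, a) ≪ t^{(1−σ)/2} log t; (iii) if σ ≤ 0 then ζ_H(σ+it, a) ≪ t^{1/2−σ} log t. -/

import Mathlib

open Complex Filter Finset MeasureTheory

/-- The Hurwitz zeta function `ζ_H(s,a)` (meromorphic continuation of
`∑ m, (m+a)^{-s}`). -/
noncomputable def hzeta (a : ℝ) (s : ℂ) : ℂ := HurwitzZeta.hurwitzZeta (a : UnitAddCircle) s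

open scoped Real Topology

/-- Powers of comparable numbers are comparable. -/
theorem rpow_le_two_rpow_abs_mul {T τ : ℝ} (hT : 0 < T) (h1 : T / 2 ≤ τ) (h2 : τ ≤ 2 * T) (A : ℝ) :
    τ ^ A ≤ 2 ^ |A| * T ^ A := by
  have hτ : 0 < τ := by linarith
  rcases le_total 0 A with hA | hA
  · rw [abs_of_nonneg hA, ← Real.mul_rpow (by norm_num) hT.le]
    exact Real.rpow_le_rpow hτ.le h2 hA
  · rw [abs_of_nonpos hA, Real.rpow_neg (by norm_num), ← Real.inv_rpow (by norm_num),
      ← Real.mul_rpow (by norm_num) hT.le]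
    exact Real.rpow_le_rpow_of_nonpos (by linarith) (by linarith) hA

/-- Logarithmic weights at comparable numbers are comparable. -/
theorem one_add_mul_log_le {T τ κ : ℝ} (hκ : 0 ≤ κ) (hT : 1 ≤ T) (hτ : 0 < τ) (h2 : τ ≤ 2 * T) :
    1 + κ * Real.log τ ≤ (1 + κ) * (1 + κ * Real.log T) := by
  have h : Real.log τ ≤ 1 + Real.log T := by
    have := Real.log_le_log hτ h2
    rw [Real.log_mul (by norm_num) (by linarith)] at this
    linarith [Real.log_two_lt_d9]
  have h0 := Real.log_nonneg hT
  nlinarith [mul_le_mul_of_nonneg_left h hκ, mul_nonneg (mul_nonneg hκ hκ) h0]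

/-- A Phragmén–Lindelöf type interpolation bound in a vertical strip of width one, in the upper
half-plane. -/
theorem exists_norm_le_interpolate {f : ℂ → ℂ} {α A B κ K t₀ : ℝ} (hκ : 0 ≤ κ) (hκ1 : κ ≤ 1)
    (hK : 0 ≤ K) (ht₀ : 1 / 2 ≤ t₀)
    (hd : ∀ s : ℂ, 0 < s.im → DifferentiableAt ℂ f s)
    (hl : ∃ C : ℝ, ∀ t : ℝ, t₀ ≤ t → ‖f (α + t * I)‖ ≤ C * t ^ A * (1 + κ * Real.log t))
    (hr : ∃ C : ℝ, ∀ t : ℝ, t₀ ≤ t →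
      ‖f ((α + 1 : ℝ) + t * I)‖ ≤ C * t ^ B * (1 + κ * Real.log t))
    (hg : ∃ C : ℝ, ∀ x ∈ Set.Icc α (α + 1), ∀ t : ℝ, t₀ ≤ t →
      ‖f (x + t * I)‖ ≤ C * Real.exp (K * t)) :
    ∃ C : ℝ, ∀ x ∈ Set.Icc α (α + 1), ∀ t : ℝ, 2 * t₀ ≤ t →
      ‖f (x + t * I)‖ ≤ C * t ^ (A + (B - A) * (x - α)) * (1 + κ * Real.log t) := by
  obtain ⟨Cl, hl⟩ := hl
  obtain ⟨Cr, hr⟩ := hr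
  obtain ⟨Cg, hg⟩ := hg
  set c : ℝ := 2 * K + (|A| + |B|) with hc
  set M : ℝ := Real.exp 1 * (1 + κ) * (2 ^ |A| * |Cl|) + Real.exp 1 * (1 + κ) * (2 ^ |B| * |Cr|) +
    |Cg| * Real.exp (1 + c ^ 2) with hM
  have hM1 : 0 ≤ Real.exp 1 * (1 + κ) * (2 ^ |A| * |Cl|) := by positivity
  have hM2 : 0 ≤ Real.exp 1 * (1 + κ) * (2 ^ |B| * |Cr|) := by positivity
  have hM3 : 0 ≤ |Cg| * Real.exp (1 + c ^ 2) := by positivity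
  refine ⟨M, fun x hx T hT => ?_⟩
  have hT0 : 0 < T := by linarith
  have hL0 : 0 ≤ Real.log T := Real.log_nonneg (by linarith)
  set W : ℝ := 1 + κ * Real.log T with hW
  have hW1 : 1 ≤ W := by rw [hW]; nlinarith [mul_nonneg hκ hL0]
  set g : ℂ → ℂ := fun s => f s * cexp (-(Real.log T : ℂ) * (A + (B - A) * (s - α)) +
    (s - α - T * I) ^ 2) with hgdef
  have hnorm (u τ : ℝ) : ‖g (u + τ * I)‖ = ‖f (u + τ * I)‖ *
      Real.exp (-Real.log T * (A + (B - A) * (u - α)) + ((u - α) ^ 2 - (τ - T) ^ 2)) := by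
    simp only [hgdef, norm_mul, Complex.norm_exp]
    congr 2
    simp [pow_two]
  have hsq {u : ℝ} (hu : u ∈ Set.Icc α (α + 1)) : (u - α) ^ 2 ≤ 1 := by
    have h1 := hu.1
    have h2 := hu.2
    nlinarith
  have hside {D E τ : ℝ} {z : ℂ} (h1 : T / 2 ≤ τ) (h2 : τ ≤ 2 * T)
      (hz : ‖f z‖ ≤ D * τ ^ E * (1 + κ * Real.log τ)) :
      ‖f z‖ * (T ^ E)⁻¹ ≤ (1 + κ) * (2 ^ |E| * |D|) * W := by
    have hτ : 0 < τ := by linarith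
    have hlog : 0 ≤ 1 + κ * Real.log τ := by
      have h3 : Real.log (1 / 2) ≤ Real.log τ := Real.log_le_log (by norm_num) (by linarith)
      rw [one_div, Real.log_inv] at h3
      nlinarith [Real.log_two_lt_d9, Real.log_two_gt_d9]
    have hTE : 0 < T ^ E := Real.rpow_pos_of_pos hT0 _
    rw [← div_eq_mul_inv, div_le_iff₀ hTE]
    calc ‖f z‖ ≤ D * τ ^ E * (1 + κ * Real.log τ) := hz
      _ ≤ |D| * (2 ^ |E| * T ^ E) * ((1 + κ) * W) := by
        gcongr
        · exact le_abs_self D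
        · exact rpow_le_two_rpow_abs_mul hT0 h1 h2 E
        · exact one_add_mul_log_le hκ (by linarith) hτ h2
      _ = _ := by ring
  have hhor {u τ : ℝ} (hu : u ∈ Set.Icc α (α + 1)) (h1 : t₀ ≤ τ) (h2 : τ ≤ 2 * T)
      (h3 : (τ - T) ^ 2 = T ^ 2 / 4) : ‖g (u + τ * I)‖ ≤ M * W := by
    rw [hnorm]
    have hexp : -Real.log T * (A + (B - A) * (u - α)) ≤ T * (|A| + |B|) := by
      have h4 : |A + (B - A) * (u - α)| ≤ |A| + |B| := by
        have h5 : 0 ≤ u - α := by linarith [hu.1]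
        have h6 : u - α ≤ 1 := by linarith [hu.2]
        have : A + (B - A) * (u - α) = (1 - (u - α)) * A + (u - α) * B := by ring
        rw [this]
        refine (abs_add_le _ _).trans ?_
        rw [abs_mul, abs_mul, abs_of_nonneg h5, abs_of_nonneg (sub_nonneg.2 h6)]
        nlinarith [abs_nonneg A, abs_nonneg B]
      have h7 : Real.log T ≤ T := (Real.log_le_sub_one_of_pos hT0).trans (by linarith)
      calc -Real.log T * (A + (B - A) * (u - α))
          ≤ |-Real.log T * (A + (B - A) * (u - α))| := le_abs_self _
        _ = Real.log T * |A + (B - A) * (u - α)| := by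
          rw [abs_mul, abs_neg, abs_of_nonneg hL0]
        _ ≤ T * (|A| + |B|) := by gcongr
    calc _ ≤ (|Cg| * Real.exp (K * τ)) *
          Real.exp (T * (|A| + |B|) + (1 - T ^ 2 / 4)) := by
          gcongr
          · exact (hg u hu τ h1).trans (by gcongr; exact le_abs_self _)
          · exact hsq hu
          · exact h3.ge
      _ = |Cg| * Real.exp (K * τ + (T * (|A| + |B|) + (1 - T ^ 2 / 4))) := by
          rw [Real.exp_add (K * τ)]; ring
      _ ≤ |Cg| * Real.exp (1 + c ^ 2) := by
          have : K * τ ≤ K * (2 * T) := by gcongr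
          refine mul_le_mul_of_nonneg_left (Real.exp_le_exp.2 ?_) (abs_nonneg Cg)
          nlinarith [sq_nonneg (c - T / 2)]
      _ ≤ M := by linarith
      _ ≤ M * W := le_mul_of_one_le_right (by linarith) hW1
  have hedge {D E u τ : ℝ} (h1 : T / 2 ≤ τ) (h2 : τ ≤ 2 * T) (hu : u ∈ Set.Icc α (α + 1))
      (hE : A + (B - A) * (u - α) = E)
      (hz : ‖f (u + τ * I)‖ ≤ D * τ ^ E * (1 + κ * Real.log τ))
      (hD : Real.exp 1 * (1 + κ) * (2 ^ |E| * |D|) * W ≤ M * W) :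
      ‖g (u + τ * I)‖ ≤ M * W := by
    rw [hnorm, hE, Real.exp_add, neg_mul, Real.exp_neg, ← Real.rpow_def_of_pos hT0, ← mul_assoc]
    have h3 : Real.exp ((u - α) ^ 2 - (τ - T) ^ 2) ≤ Real.exp 1 :=
      Real.exp_le_exp.2 (by linarith [hsq hu, sq_nonneg (τ - T)])
    calc _ ≤ (1 + κ) * (2 ^ |E| * |D|) * W * Real.exp 1 := by
          exact mul_le_mul (hside h1 h2 hz) h3 (Real.exp_pos _).le (by positivity)
      _ = Real.exp 1 * (1 + κ) * (2 ^ |E| * |D|) * W := by ring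
      _ ≤ M * W := hD
  have hsub : ∀ s ∈ Set.Icc α (α + 1) ×ℂ Set.Icc (T / 2) (3 * T / 2), 0 < s.im := by
    intro s hs
    have := (Complex.mem_reProdIm.1 hs).2.1
    linarith
  have hcl : closure (Set.Ioo α (α + 1) ×ℂ Set.Ioo (T / 2) (3 * T / 2)) =
      Set.Icc α (α + 1) ×ℂ Set.Icc (T / 2) (3 * T / 2) := by
    rw [closure_reProdIm, closure_Ioo (by linarith), closure_Ioo (by linarith)]
  have hfin : ‖g (x + T * I)‖ ≤ M * W := by
    refine Complex.norm_le_of_forall_mem_frontier_norm_le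
      (U := Set.Ioo α (α + 1) ×ℂ Set.Ioo (T / 2) (3 * T / 2))
      ((Metric.isBounded_Ioo _ _).reProdIm (Metric.isBounded_Ioo _ _)) ?_ ?_ ?_
    · apply DifferentiableOn.diffContOnCl
      rw [hcl]
      intro s hs
      apply DifferentiableAt.differentiableWithinAt
      exact (hd s (hsub s hs)).mul (by fun_prop)
    · intro z hz
      rw [frontier_reProdIm, closure_Ioo (by linarith), closure_Ioo (by linarith),
        frontier_Ioo (by linarith), frontier_Ioo (by linarith)] at hz
      have hzz : z = (z.re : ℂ) + (z.im : ℂ) * I := (Complex.re_add_im z).symm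
      rw [hzz]
      rcases hz with hz | hz
      · obtain ⟨hu, hτ⟩ := Complex.mem_reProdIm.1 hz
        rcases hτ with h | h
        · exact hhor hu (by rw [h]; linarith) (by rw [h]; linarith) (by rw [h]; ring)
        · rw [Set.mem_singleton_iff] at h
          exact hhor hu (by rw [h]; linarith) (by rw [h]; linarith) (by rw [h]; ring)
      · obtain ⟨hu, hτ1, hτ2⟩ := Complex.mem_reProdIm.1 hz
        rcases hu with h | h
        · rw [h]
          exact hedge hτ1 (by linarith) (by simp) (by rw [sub_self, mul_zero, add_zero])
            (hl z.im (by linarith)) (by nlinarith)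
        · rw [Set.mem_singleton_iff] at h
          rw [h]
          exact hedge hτ1 (by linarith) (by simp) (by ring) (hr z.im (by linarith)) (by nlinarith)
    · rw [hcl, Complex.mem_reProdIm]
      simp only [add_re, ofReal_re, mul_re, I_re, mul_zero, ofReal_im, I_im, mul_one, sub_self,
        add_zero, add_im, mul_im, zero_add]
      exact ⟨hx, by constructor <;> linarith⟩
  rw [hnorm, sub_self, Real.exp_add, show -Real.log T * (A + (B - A) * (x - α)) =
    -(Real.log T * (A + (B - A) * (x - α))) by ring, Real.exp_neg,
    ← Real.rpow_def_of_pos hT0] at hfin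
  have hpos : 0 < T ^ (A + (B - A) * (x - α)) := Real.rpow_pos_of_pos hT0 _
  have h1 : 1 ≤ Real.exp ((x - α) ^ 2 - 0 ^ 2) := Real.one_le_exp (by nlinarith [sq_nonneg (x - α)])
  have h2 : ‖f (x + T * I)‖ * (T ^ (A + (B - A) * (x - α)))⁻¹ ≤ M * W := by
    refine le_trans ?_ hfin
    gcongr
    exact le_mul_of_one_le_right (by positivity) h1
  rw [← div_eq_mul_inv, div_le_iff₀ hpos] at h2
  linarith

theorem norm_Gamma_le_Gamma_re {s : ℂ} (hs : 0 < s.re) : ‖Complex.Gamma s‖ ≤ Real.Gamma s.re := by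
  rw [Complex.Gamma_eq_integral hs, Real.Gamma_eq_integral hs, Complex.GammaIntegral]
  refine (norm_integral_le_integral_norm _).trans (le_of_eq ?_)
  refine setIntegral_congr_fun measurableSet_Ioi fun x hx => ?_
  rw [Set.mem_Ioi] at hx
  simp only [norm_mul]
  rw [Complex.norm_cpow_eq_rpow_re_of_pos hx, Complex.norm_of_nonneg (Real.exp_pos _).le]
  simp

/-- The Gamma function with its exponential decay in the upper half-plane removed. -/
noncomputable def gammaMulExp (s : ℂ) : ℂ := Complex.Gamma s * cexp (-(π * I / 2) * s)

theorem norm_gammaMulExp (x t : ℝ) :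
    ‖gammaMulExp (x + t * I)‖ = ‖Complex.Gamma (x + t * I)‖ * Real.exp (π * t / 2) := by
  rw [gammaMulExp, norm_mul, Complex.norm_exp]
  congr 2
  simp
  ring

theorem norm_Gamma_one_add_mul_I_sq {t : ℝ} (ht : 0 < t) :
    ‖Complex.Gamma (1 + t * I)‖ ^ 2 = π * t / Real.sinh (π * t) := by
  have htI : (t * I : ℂ) ≠ 0 := by simp [ht.ne']
  have h1 : Complex.Gamma (1 + t * I) = t * I * Complex.Gamma (t * I) := by
    rw [add_comm, Complex.Gamma_add_one _ htI]
  have h2 : ‖Complex.Gamma (1 - t * I)‖ = ‖Complex.Gamma (1 + t * I)‖ := by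
    rw [← Complex.norm_conj, ← Complex.Gamma_conj]
    simp
  have h3 := congrArg norm (Complex.Gamma_mul_Gamma_one_sub (t * I))
  rw [norm_mul, h2, show (π * (t * I) : ℂ) = ((π * t : ℝ) : ℂ) * I by push_cast; ring,
    Complex.sin_mul_I, norm_div, norm_mul, norm_I, mul_one, ← Complex.ofReal_sinh,
    Complex.norm_real, Complex.norm_real, Real.norm_of_nonneg Real.pi_pos.le,
    Real.norm_of_nonneg (Real.sinh_pos_iff.2 (by positivity)).le] at h3
  have h4 : ‖Complex.Gamma (1 + t * I)‖ = t * ‖Complex.Gamma (t * I)‖ := by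
    rw [h1, norm_mul, norm_mul, norm_I, mul_one, Complex.norm_of_nonneg ht.le]
  calc _ = t * (‖Complex.Gamma (t * I)‖ * ‖Complex.Gamma (1 + t * I)‖) := by
        rw [pow_two]; nth_rewrite 1 [h4]; ring
    _ = _ := by rw [h3]; ring

theorem exists_norm_gammaMulExp_nat_le (n : ℕ) : ∃ C : ℝ, ∀ t : ℝ, 1 / 2 ≤ t →
    ‖gammaMulExp ((n + 1 : ℝ) + t * I)‖ ≤ C * t ^ (n + 1 / 2 : ℝ) := by
  induction n with
  | zero =>
    refine ⟨√(4 * π), fun t ht => ?_⟩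
    have ht0 : 0 < t := by linarith
    have h1 := norm_gammaMulExp 1 t
    rw [Complex.ofReal_one] at h1
    simp only [Nat.cast_zero, zero_add]
    rw [← Real.sqrt_eq_rpow, ← Real.sqrt_mul (by positivity), Complex.ofReal_one, h1]
    apply Real.le_sqrt_of_sq_le
    rw [mul_pow, norm_Gamma_one_add_mul_I_sq ht0, ← Real.exp_nat_mul,
      show ((2 : ℕ) : ℝ) * (π * t / 2) = π * t by push_cast; ring, Real.sinh_eq]
    have h2 : 1 ≤ π * t := by nlinarith [Real.pi_gt_three]
    have h3 : 2 ≤ Real.exp (π * t) := by linarith [Real.add_one_le_exp (π * t)]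
    have h4 : Real.exp (-(π * t)) ≤ 1 := Real.exp_le_one_iff.2 (by linarith)
    rw [div_mul_eq_mul_div, div_le_iff₀ (by linarith)]
    have : 0 < π * t := by linarith
    nlinarith
  | succ n ih =>
    obtain ⟨C, hC⟩ := ih
    refine ⟨(2 * n + 3) * C, fun t ht => ?_⟩
    have ht0 : 0 < t := by linarith
    have hrec : Complex.Gamma (((n + 1 : ℕ) + 1 : ℝ) + t * I) =
        ((n + 1 : ℝ) + t * I) * Complex.Gamma ((n + 1 : ℝ) + t * I) := by
      rw [← Complex.Gamma_add_one]
      · congr 1; push_cast; ring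
      · intro h
        have := congrArg Complex.im h
        simp at this
        linarith
    have hn : ‖((n + 1 : ℝ) + t * I : ℂ)‖ ≤ (2 * n + 3) * t := by
      refine (norm_add_le _ _).trans ?_
      rw [norm_mul, norm_I, mul_one, Complex.norm_real, Complex.norm_real,
        Real.norm_of_nonneg (by positivity), Real.norm_of_nonneg ht0.le]
      nlinarith [(Nat.cast_nonneg n : (0 : ℝ) ≤ n)]
    have h1 := norm_gammaMulExp ((n + 1 : ℕ) + 1) t
    have h2 := hC t ht
    rw [norm_gammaMulExp] at h2
    have h1' : ‖gammaMulExp ((((n + 1 : ℕ) : ℝ) + 1 : ℝ) + t * I)‖ = _ := h1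
    push_cast at h1' hrec h2 hn ⊢
    rw [h1', hrec, norm_mul, mul_assoc,
      show (n + 1 + 1 / 2 : ℝ) = 1 + (n + 1 / 2) by ring, Real.rpow_add ht0, Real.rpow_one]
    calc _ ≤ ((2 * n + 3) * t) * (C * t ^ (n + 1 / 2 : ℝ)) := by gcongr
      _ = _ := by ring

/-- Stirling's upper bound for the Gamma function on a vertical line to the right of `1`. -/
theorem exists_norm_Gamma_le {x : ℝ} (hx : 1 ≤ x) : ∃ C : ℝ, ∀ t : ℝ, 1 ≤ t →
    ‖Complex.Gamma (x + t * I)‖ ≤ C * t ^ (x - 1 / 2) * Real.exp (-(π * t / 2)) := by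
  obtain ⟨n, hn⟩ : ∃ n : ℕ, x ∈ Set.Icc (n + 1 : ℝ) (n + 1 + 1) := by
    refine ⟨⌊x - 1⌋₊, ?_, ?_⟩
    · linarith [Nat.floor_le (sub_nonneg.2 hx)]
    · linarith [Nat.lt_floor_add_one (x - 1)]
  have key := exists_norm_le_interpolate (f := gammaMulExp) (α := n + 1) (A := n + 1 / 2)
    (B := (n + 1 : ℕ) + 1 / 2) (κ := 0) (K := π / 2) (t₀ := 1 / 2) le_rfl zero_le_one
    (by positivity) le_rfl ?_ ?_ ?_ ?_
  · obtain ⟨C, hC⟩ := key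
    refine ⟨C, fun t ht => ?_⟩
    have h := hC x hn t (by linarith)
    rw [norm_gammaMulExp, show (n + 1 / 2 + (((n + 1 : ℕ) : ℝ) + 1 / 2 - (n + 1 / 2)) *
      (x - (n + 1)) : ℝ) = x - 1 / 2 by push_cast; ring, zero_mul, add_zero, mul_one] at h
    rw [Real.exp_neg, ← div_eq_mul_inv, le_div_iff₀ (Real.exp_pos _)]
    exact h
  · intro s hs
    refine (Complex.differentiableAt_Gamma s fun m h => ?_).mul (by fun_prop)
    rw [h] at hs
    simp at hs
  · simpa using exists_norm_gammaMulExp_nat_le n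
  · simpa using exists_norm_gammaMulExp_nat_le (n + 1)
  · have hcont : ContinuousOn Real.Gamma (Set.Icc (n + 1 : ℝ) (n + 1 + 1)) := by
      intro y hy
      refine (Real.differentiableAt_Gamma fun m h => ?_).continuousAt.continuousWithinAt
      have := hy.1
      have h3 : (0 : ℝ) ≤ n := Nat.cast_nonneg n
      have h4 : (0 : ℝ) ≤ m := Nat.cast_nonneg m
      linarith
    obtain ⟨C, hC⟩ := isCompact_Icc.exists_bound_of_continuousOn hcont
    refine ⟨C, fun y hy t ht => ?_⟩
    rw [norm_gammaMulExp, show π * t / 2 = π / 2 * t by ring]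
    gcongr
    have hy0 : (0 : ℝ) < y := by
      have := hy.1
      have h3 : (0 : ℝ) ≤ n := Nat.cast_nonneg n
      linarith
    have h := norm_Gamma_le_Gamma_re (s := y + t * I) (by simpa using hy0)
    simp only [add_re, ofReal_re, mul_re, I_re, mul_zero, ofReal_im, I_im, mul_one, sub_self,
      add_zero] at h
    exact h.trans ((Real.le_norm_self _).trans (hC y hy))

theorem norm_cpow_sub_cpow_le {y x : ℝ} (hy : 0 < y) (hx : x ∈ Set.Icc y (y + 1)) {w : ℂ}
    (hw : 0 < w.re) : ‖(x : ℂ) ^ (-w) - (y : ℂ) ^ (-w)‖ ≤ ‖w‖ * y ^ (-w.re - 1) := by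
  have hw0 : -w ≠ 0 := by
    intro h
    rw [neg_eq_zero.1 h] at hw
    simp at hw
  have hd : ∀ u ∈ Set.Icc y (y + 1), HasDerivWithinAt (fun u : ℝ => (u : ℂ) ^ (-w))
      (-w * (u : ℂ) ^ (-w - 1)) (Set.Icc y (y + 1)) u := by
    intro u hu
    have hu0 : u ≠ 0 := (hy.trans_le hu.1).ne'
    exact (hasDerivAt_ofReal_cpow_const hu0 hw0).hasDerivWithinAt
  have hb : ∀ u ∈ Set.Icc y (y + 1), ‖-w * (u : ℂ) ^ (-w - 1)‖ ≤ ‖w‖ * y ^ (-w.re - 1) := by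
    intro u hu
    rw [norm_mul, norm_neg, Complex.norm_cpow_eq_rpow_re_of_pos (hy.trans_le hu.1)]
    simp only [sub_re, neg_re, one_re]
    gcongr ?_ * ?_
    exact Real.rpow_le_rpow_of_nonpos hy hu.1 (by linarith)
  have h := Convex.norm_image_sub_le_of_norm_hasDerivWithin_le hd hb (convex_Icc _ _)
    (Set.left_mem_Icc.2 (by linarith)) hx
  refine h.trans (mul_le_of_le_one_right (by positivity) ?_)
  rw [Real.norm_eq_abs, abs_of_nonneg (by linarith [hx.1])]
  linarith [hx.2]

/-- Comparison of a term of a Dirichlet series with the integral over the following unit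
interval. -/
theorem norm_cpow_sub_integral_le {y : ℝ} (hy : 0 < y) {w : ℂ} (hw : 0 < w.re) (hw1 : w ≠ 1) :
    ‖(y : ℂ) ^ (-w) - (y : ℂ) ^ (1 - w) / (w - 1) + ((y + 1 : ℝ) : ℂ) ^ (1 - w) / (w - 1)‖ ≤
      ‖w‖ * y ^ (-w.re - 1) := by
  have hw1' : w - 1 ≠ 0 := sub_ne_zero.2 hw1
  have hw1'' : 1 - w ≠ 0 := sub_ne_zero.2 hw1.symm
  have hd : ∀ u ∈ Set.Icc y (y + 1), HasDerivWithinAt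
      (fun u : ℝ => (u : ℂ) ^ (1 - w) / (w - 1) + (y : ℂ) ^ (-w) * u)
      (-((u : ℂ) ^ (-w) - (y : ℂ) ^ (-w))) (Set.Icc y (y + 1)) u := by
    intro u hu
    have hu0 : u ≠ 0 := (hy.trans_le hu.1).ne'
    have h := (hasDerivAt_ofReal_cpow_const' hu0 (r := -w) (fun h => hw1 (neg_inj.1 h))).neg
    have h2 := h.add ((Complex.ofRealCLM.hasDerivAt (x := u)).const_mul ((y : ℂ) ^ (-w)))
    refine HasDerivAt.hasDerivWithinAt ?_
    convert! h2 using 1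
    · ext v
      simp only [Pi.add_apply, Pi.neg_apply, Complex.ofRealCLM_apply]
      rw [show -w + 1 = 1 - w by ring]
      field_simp
      ring
    · simp
      ring
  have hb : ∀ u ∈ Set.Icc y (y + 1),
      ‖-((u : ℂ) ^ (-w) - (y : ℂ) ^ (-w))‖ ≤ ‖w‖ * y ^ (-w.re - 1) := by
    intro u hu
    rw [norm_neg]
    exact norm_cpow_sub_cpow_le hy hu hw
  have h := Convex.norm_image_sub_le_of_norm_hasDerivWithin_le hd hb (convex_Icc _ _)
    (Set.left_mem_Icc.2 (by linarith)) (Set.right_mem_Icc.2 (by linarith))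
  rw [add_sub_cancel_left, norm_one, mul_one] at h
  refine le_trans (le_of_eq ?_) h
  congr 1
  push_cast
  ring

/-- The terms of the series obtained by partial summation from `∑ c n * (n + b) ^ (-w)`, when the
coefficients `c n` have mean value `κ`. -/
noncomputable def abelTerm (c : ℕ → ℂ) (κ : ℂ) (b : ℝ) (w : ℂ) (n : ℕ) : ℂ :=
  κ * (((n + b : ℝ) : ℂ) ^ (-w) - ((n + b : ℝ) : ℂ) ^ (1 - w) / (w - 1) +
      ((n + b + 1 : ℝ) : ℂ) ^ (1 - w) / (w - 1)) +
    (∑ m ∈ range (n + 1), (c m - κ)) *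
      (((n + b : ℝ) : ℂ) ^ (-w) - ((n + b + 1 : ℝ) : ℂ) ^ (-w))

section DirichletSeries

variable {c : ℕ → ℂ} {κ : ℂ} {b B : ℝ}

theorem norm_abelTerm_le (hb : 0 < b) (hB : ∀ n, ‖∑ m ∈ range n, (c m - κ)‖ ≤ B) {w : ℂ}
    (hw : 0 < w.re) (hw1 : w ≠ 1) (n : ℕ) :
    ‖abelTerm c κ b w n‖ ≤ (‖κ‖ + B) * ‖w‖ * (n + b) ^ (-w.re - 1) := by
  have hnb : 0 < n + b := by positivity
  have h1 := norm_cpow_sub_integral_le hnb hw hw1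
  have h2 := norm_cpow_sub_cpow_le hnb (Set.right_mem_Icc.2 (by linarith)) hw
  rw [norm_sub_rev] at h2
  calc _ ≤ ‖κ‖ * (‖w‖ * (n + b) ^ (-w.re - 1)) + B * (‖w‖ * (n + b) ^ (-w.re - 1)) := by
        refine (norm_add_le _ _).trans ?_
        rw [norm_mul, norm_mul]
        have hB0 : 0 ≤ B := (norm_nonneg _).trans (hB 0)
        gcongr
        exact hB _
    _ = _ := by ring

theorem sum_abelTerm (w : ℂ) (N : ℕ) :
    ∑ n ∈ range N, abelTerm c κ b w n =
      ∑ n ∈ range N, c n * ((n + b : ℝ) : ℂ) ^ (-w) - κ * ((b : ℂ) ^ (1 - w) / (w - 1)) +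
        κ * (((N + b : ℝ) : ℂ) ^ (1 - w) / (w - 1)) -
        (∑ m ∈ range N, (c m - κ)) * ((N + b : ℝ) : ℂ) ^ (-w) := by
  induction N with
  | zero => simp
  | succ N ih =>
    rw [sum_range_succ, ih, sum_range_succ _ N, abelTerm, sum_range_succ _ N,
      show ((N + 1 : ℕ) : ℝ) + b = N + b + 1 by push_cast; ring]
    ring

theorem summable_nat_add_rpow (hb : 0 < b) {p : ℝ} (hp : 0 < p) :
    Summable fun n : ℕ => (n + b) ^ (-p - 1) := by
  refine ((Real.summable_one_div_nat_add_rpow b (p + 1)).2 (by linarith)).congr fun n => ?_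
  have : 0 < n + b := by positivity
  rw [abs_of_pos this, one_div, ← Real.rpow_neg this.le]
  congr 1
  ring

theorem summable_abelTerm (hb : 0 < b) (hB : ∀ n, ‖∑ m ∈ range n, (c m - κ)‖ ≤ B) {w : ℂ}
    (hw : 0 < w.re) (hw1 : w ≠ 1) : Summable (abelTerm c κ b w) :=
  Summable.of_norm_bounded ((summable_nat_add_rpow hb hw).mul_left ((‖κ‖ + B) * ‖w‖))
    (norm_abelTerm_le hb hB hw hw1)

theorem tendsto_nat_add_cpow_zero (hb : 0 < b) {w : ℂ} (hw : w.re < 0) :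
    Tendsto (fun n : ℕ => ((n + b : ℝ) : ℂ) ^ w) atTop (𝓝 0) := by
  rw [tendsto_zero_iff_norm_tendsto_zero]
  have h := (tendsto_rpow_neg_atTop (neg_pos.2 hw)).comp
    (tendsto_atTop_add_const_right _ b tendsto_natCast_atTop_atTop)
  refine h.congr fun n => ?_
  have : 0 < n + b := by positivity
  rw [Complex.norm_cpow_eq_rpow_re_of_pos this, Function.comp_apply, neg_neg]

theorem tsum_abelTerm (hb : 0 < b) (hB : ∀ n, ‖∑ m ∈ range n, (c m - κ)‖ ≤ B) {w l : ℂ}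
    (hw : 1 < w.re) (hl : HasSum (fun n : ℕ => c n * ((n + b : ℝ) : ℂ) ^ (-w)) l) :
    ∑' n, abelTerm c κ b w n = l - κ * ((b : ℂ) ^ (1 - w) / (w - 1)) := by
  have hw1 : w ≠ 1 := by
    rintro rfl
    simp at hw
  have h1 := (summable_abelTerm hb hB (by linarith) hw1).hasSum.tendsto_sum_nat
  simp_rw [sum_abelTerm] at h1
  refine tendsto_nhds_unique h1 ?_
  have h2 := (tendsto_nat_add_cpow_zero hb (w := 1 - w) (by simp; linarith)).div_const (w - 1)
  have h3 : Tendsto (fun N : ℕ => (∑ m ∈ range N, (c m - κ)) * ((N + b : ℝ) : ℂ) ^ (-w)) atTop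
      (𝓝 0) := by
    have h4 := tendsto_nat_add_cpow_zero hb (w := -w) (by simp; linarith)
    rw [tendsto_zero_iff_norm_tendsto_zero] at h4 ⊢
    refine squeeze_zero (g := fun N : ℕ => B * ‖((N + b : ℝ) : ℂ) ^ (-w)‖)
      (fun N => norm_nonneg _) (fun N => ?_) (by simpa using h4.const_mul B)
    rw [norm_mul]
    exact mul_le_mul_of_nonneg_right (hB N) (norm_nonneg _)
  simpa using ((hl.tendsto_sum_nat.sub_const (κ * ((b : ℂ) ^ (1 - w) / (w - 1)))).add
    (h2.const_mul κ)).sub h3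

theorem rpow_le_rpow_add_rpow {y p q r : ℝ} (hy : 0 < y) (hpq : p ≤ q) (hqr : q ≤ r) :
    y ^ q ≤ y ^ p + y ^ r := by
  have h1 := Real.rpow_pos_of_pos hy p
  have h2 := Real.rpow_pos_of_pos hy r
  rcases le_total 1 y with h | h
  · linarith [Real.rpow_le_rpow_of_exponent_le h hqr]
  · linarith [Real.rpow_le_rpow_of_exponent_ge hy h hpq]

/-- Analytic continuation by partial summation. -/
theorem eq_add_tsum_abelTerm (hb : 0 < b) (hB : ∀ n, ‖∑ m ∈ range n, (c m - κ)‖ ≤ B) {L : ℂ → ℂ}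
    (hd : ∀ s : ℂ, s ≠ 1 → DifferentiableAt ℂ L s)
    (hL : ∀ s : ℂ, 1 < s.re → HasSum (fun n : ℕ => c n * ((n + b : ℝ) : ℂ) ^ (-s)) (L s)) {w : ℂ}
    (hw : 0 < w.re) (hwi : w.im ≠ 0) :
    L w = κ * ((b : ℂ) ^ (1 - w) / (w - 1)) + ∑' n, abelTerm c κ b w n := by
  set R : ℝ := ‖w‖ + 3 with hR
  set U : Set ℂ := {z | w.re / 2 < z.re} ∩ {z | 0 < w.im * z.im} ∩ Metric.ball 0 R with hU
  have hopen : IsOpen U := by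
    refine IsOpen.inter (IsOpen.inter ?_ ?_) Metric.isOpen_ball
    · exact isOpen_lt continuous_const Complex.continuous_re
    · exact isOpen_lt continuous_const (by fun_prop)
  have hconv : Convex ℝ U := by
    refine Convex.inter (Convex.inter ?_ ?_) (convex_ball _ _)
    · exact convex_halfSpace_re_gt _
    · exact convex_halfSpace_gt (f := fun z : ℂ => w.im * z.im)
        ⟨fun x y => by simp [mul_add], fun a x => by simp; ring⟩ 0
  have hne : ∀ z ∈ U, z ≠ 1 := by
    rintro z ⟨⟨_, hz⟩, _⟩ rfl
    simp at hz
  have hre : ∀ z ∈ U, w.re / 2 < z.re := fun z hz => hz.1.1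
  have hnorm : ∀ z ∈ U, ‖z‖ ≤ R := fun z hz => (mem_ball_zero_iff.1 hz.2).le
  have hB0 : 0 ≤ B := (norm_nonneg _).trans (hB 0)
  have hR0 : 0 < R := by positivity
  have hb0 : (b : ℂ) ≠ 0 := by exact_mod_cast hb.ne'
  have hterm : ∀ n : ℕ, DifferentiableOn ℂ (fun z => abelTerm c κ b z n) U := by
    intro n z hz
    have hz1 : z - 1 ≠ 0 := sub_ne_zero.2 (hne z hz)
    have h1 : ((n + b : ℝ) : ℂ) ≠ 0 := by
      have : 0 < n + b := by positivity
      exact_mod_cast this.ne'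
    have h2 : ((n + b + 1 : ℝ) : ℂ) ≠ 0 := by
      have : 0 < n + b + 1 := by positivity
      exact_mod_cast this.ne'
    unfold abelTerm
    apply DifferentiableAt.differentiableWithinAt
    fun_prop (disch := first | assumption | exact Or.inl (by assumption))
  have hsum : DifferentiableOn ℂ (fun z => ∑' n, abelTerm c κ b z n) U := by
    refine differentiableOn_tsum_of_summable_norm
      (u := fun n : ℕ => (‖κ‖ + B) * R * ((n + b) ^ (-R - 1) + (n + b) ^ (-(w.re / 2) - 1)))
      (((summable_nat_add_rpow hb hR0).add
        (summable_nat_add_rpow hb (half_pos hw))).mul_left _) hterm hopen fun n z hz => ?_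
    have hz := hre z hz
    have hzR := hnorm z ‹_›
    refine (norm_abelTerm_le hb hB (by linarith) (hne z ‹_›) n).trans ?_
    have hnb : 0 < n + b := by positivity
    gcongr
    refine rpow_le_rpow_add_rpow hnb ?_ (by linarith)
    linarith [Complex.re_le_norm z]
  have hRHS : DifferentiableOn ℂ
      (fun z => κ * ((b : ℂ) ^ (1 - z) / (z - 1)) + ∑' n, abelTerm c κ b z n) U := by
    refine DifferentiableOn.add (fun z hz => ?_) hsum
    have hz1 : z - 1 ≠ 0 := sub_ne_zero.2 (hne z hz)
    apply DifferentiableAt.differentiableWithinAt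
    fun_prop (disch := first | assumption | exact Or.inl (by assumption))
  have hLHS : DifferentiableOn ℂ L U := fun z hz => (hd z (hne z hz)).differentiableWithinAt
  have hwU : w ∈ U := by
    refine ⟨⟨?_, ?_⟩, ?_⟩
    · change w.re / 2 < w.re
      linarith
    · exact mul_self_pos.2 hwi
    · rw [mem_ball_zero_iff]
      linarith
  have hwr := Complex.re_le_norm w
  obtain ⟨z₀, hz₀, hz₀r⟩ : ∃ z₀ ∈ U, 1 < z₀.re := by
    refine ⟨w + 2, ⟨⟨?_, ?_⟩, ?_⟩, by simp; linarith⟩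
    · change w.re / 2 < (w + 2).re
      simp
      linarith
    · change 0 < w.im * (w + 2).im
      simpa using hwi
    · rw [mem_ball_zero_iff]
      refine (norm_add_le _ _).trans_lt ?_
      simp [hR]
      norm_num
  refine (hLHS.analyticOnNhd hopen).eqOn_of_preconnected_of_eventuallyEq
    (hRHS.analyticOnNhd hopen) hconv.isPreconnected hz₀ ?_ hwU
  filter_upwards [(isOpen_lt continuous_const Complex.continuous_re).mem_nhds hz₀r] with z hz
  rw [tsum_abelTerm hb hB hz (hL z hz)]
  ring

theorem norm_le_of_hasSum_of_re_pos (hb : 0 < b) (hB : ∀ n, ‖∑ m ∈ range n, (c m - κ)‖ ≤ B)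
    {L : ℂ → ℂ} (hd : ∀ s : ℂ, s ≠ 1 → DifferentiableAt ℂ L s)
    (hL : ∀ s : ℂ, 1 < s.re → HasSum (fun n : ℕ => c n * ((n + b : ℝ) : ℂ) ^ (-s)) (L s)) {w : ℂ}
    (hw : 0 < w.re) (hwi : w.im ≠ 0) :
    ‖L w‖ ≤ ‖κ‖ * (b ^ (1 - w.re) / |w.im|) +
      (‖κ‖ + B) * ‖w‖ * ∑' n : ℕ, (n + b) ^ (-w.re - 1) := by
  have hw1 : w ≠ 1 := by
    rintro rfl
    simp at hwi
  rw [eq_add_tsum_abelTerm hb hB hd hL hw hwi]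
  refine (norm_add_le _ _).trans (add_le_add ?_ ?_)
  · rw [norm_mul, norm_div, Complex.norm_cpow_eq_rpow_re_of_pos hb]
    simp only [sub_re, one_re]
    gcongr
    simpa using Complex.abs_im_le_norm (w - 1)
  · rw [← tsum_mul_left]
    exact tsum_of_norm_bounded ((summable_nat_add_rpow hb hw).mul_left _).hasSum
      (norm_abelTerm_le hb hB hw hw1)

theorem tsum_nat_add_rpow_le (hb : 1 < b) : ∑' n : ℕ, (n + b) ^ (-1 - 1 : ℝ) ≤ 1 / (b - 1) := by
  refine Real.tsum_le_of_sum_range_le (fun n => by positivity) fun N => ?_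
  suffices h : ∑ n ∈ range N, (n + b) ^ (-1 - 1 : ℝ) ≤ 1 / (b - 1) - 1 / (N + b - 1) by
    have : 0 < N + b - 1 := by linarith [(Nat.cast_nonneg N : (0 : ℝ) ≤ N)]
    have : 0 < 1 / (N + b - 1) := by positivity
    linarith
  induction N with
  | zero => simp
  | succ N ih =>
    rw [sum_range_succ]
    have hN : (0 : ℝ) ≤ N := Nat.cast_nonneg N
    have h1 : 0 < N + b - 1 := by linarith
    have h2 : 0 < N + b := by linarith
    have h3 : (N + b) ^ (-1 - 1 : ℝ) ≤ 1 / (N + b - 1) - 1 / (N + b) := by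
      rw [show (-1 - 1 : ℝ) = -(2 : ℕ) by norm_num, Real.rpow_neg h2.le, Real.rpow_natCast,
        div_sub_div _ _ h1.ne' h2.ne', inv_eq_one_div, div_le_div_iff₀ (by positivity)
        (by positivity)]
      nlinarith
    have h4 : ((N + 1 : ℕ) : ℝ) + b - 1 = N + b := by push_cast; ring
    rw [h4]
    linarith

theorem sum_range_one_div_add_le (hb : 0 < b) (N : ℕ) :
    ∑ n ∈ range (N + 1), 1 / (n + b) ≤ 1 / b + (1 + Real.log N) := by
  rw [sum_range_succ', Nat.cast_zero, zero_add, add_comm]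
  refine add_le_add_right ?_ _
  refine le_trans ?_ (harmonic_le_one_add_log N)
  rw [harmonic]
  push_cast
  refine sum_le_sum fun n _ => ?_
  rw [← one_div]
  exact one_div_le_one_div_of_le (by positivity) (by linarith)

end DirichletSeries

/-- `L` is the analytic continuation to `ℂ \ {1}` of a Dirichlet series `∑ c n * (n + b) ^ (-s)`
whose coefficients are bounded by `1` and sum to `κ * n + O(1)`. -/
def IsMeanDirichletSeries (L : ℂ → ℂ) : Prop :=
  ∃ (c : ℕ → ℂ) (κ : ℂ) (b B : ℝ), 0 < b ∧ (∀ n, ‖c n‖ ≤ 1) ∧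
    (∀ n, ‖∑ m ∈ range n, (c m - κ)‖ ≤ B) ∧ (∀ s : ℂ, s ≠ 1 → DifferentiableAt ℂ L s) ∧
    ∀ s : ℂ, 1 < s.re → HasSum (fun n : ℕ => c n * ((n + b : ℝ) : ℂ) ^ (-s)) (L s)

namespace IsMeanDirichletSeries

variable {L : ℂ → ℂ}

theorem exists_norm_le_of_one_lt (h : IsMeanDirichletSeries L) {σ : ℝ} (hσ : 1 < σ) :
    ∃ C : ℝ, ∀ t : ℝ, ‖L (σ + t * I)‖ ≤ C := by
  obtain ⟨c, κ, b, B, hb, hc, -, -, hL⟩ := h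
  refine ⟨∑' n : ℕ, (n + b) ^ (-(σ - 1) - 1), fun t => ?_⟩
  have hs := hL (σ + t * I) (by simpa using hσ)
  refine hs.norm_le_of_bounded (summable_nat_add_rpow hb (sub_pos.2 hσ)).hasSum fun n => ?_
  have hnb : 0 < n + b := by positivity
  rw [norm_mul, Complex.norm_cpow_eq_rpow_re_of_pos hnb]
  refine (mul_le_of_le_one_left (by positivity) (hc n)).trans (le_of_eq ?_)
  congr 1
  simp

theorem exists_norm_le_mul_norm (h : IsMeanDirichletSeries L) :
    ∃ C : ℝ, 0 ≤ C ∧ ∀ w : ℂ, 1 / 2 ≤ w.re → w.re ≤ 1 → 1 ≤ |w.im| → ‖L w‖ ≤ C * ‖w‖ := by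
  obtain ⟨c, κ, b, B, hb, -, hB, hd, hL⟩ := h
  have hB0 : 0 ≤ B := (norm_nonneg _).trans (hB 0)
  have hS1 := summable_nat_add_rpow hb (p := 1) one_pos
  have hS2 := summable_nat_add_rpow hb (p := 1 / 2) one_half_pos
  refine ⟨‖κ‖ * (b ^ (0 : ℝ) + b ^ (1 / 2 : ℝ)) + (‖κ‖ + B) *
    ∑' n : ℕ, ((n + b) ^ (-1 - 1 : ℝ) + (n + b) ^ (-(1 / 2) - 1 : ℝ)), ?_,
    fun w h1 h2 h3 => ?_⟩
  · have : 0 ≤ ∑' n : ℕ, ((n + b) ^ (-1 - 1 : ℝ) + (n + b) ^ (-(1 / 2) - 1 : ℝ)) :=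
      tsum_nonneg fun n => by positivity
    positivity
  have hw : 0 < w.re := by linarith
  have hwi : w.im ≠ 0 := by
    intro h
    rw [h, abs_zero] at h3
    linarith
  have hw1 : 1 ≤ ‖w‖ := h3.trans (Complex.abs_im_le_norm w)
  have hsum : ∑' n : ℕ, (n + b) ^ (-w.re - 1) ≤
      ∑' n : ℕ, ((n + b) ^ (-1 - 1 : ℝ) + (n + b) ^ (-(1 / 2) - 1 : ℝ)) := by
    refine Summable.tsum_le_tsum (fun n => ?_) (summable_nat_add_rpow hb hw) (hS1.add hS2)
    exact rpow_le_rpow_add_rpow (by positivity) (by linarith) (by linarith)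
  have hbw : b ^ (1 - w.re) / |w.im| ≤ b ^ (0 : ℝ) + b ^ (1 / 2 : ℝ) :=
    (div_le_self (by positivity) h3).trans
      (rpow_le_rpow_add_rpow hb (by linarith) (by linarith))
  calc ‖L w‖ ≤ _ := norm_le_of_hasSum_of_re_pos hb hB hd hL hw hwi
    _ ≤ ‖κ‖ * (b ^ (0 : ℝ) + b ^ (1 / 2 : ℝ)) * ‖w‖ + (‖κ‖ + B) * ‖w‖ *
        ∑' n : ℕ, ((n + b) ^ (-1 - 1 : ℝ) + (n + b) ^ (-(1 / 2) - 1 : ℝ)) := by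
      refine add_le_add ?_ (mul_le_mul_of_nonneg_left hsum (by positivity))
      exact (mul_le_mul_of_nonneg_left hbw (norm_nonneg κ)).trans
        (le_mul_of_one_le_right (by positivity) hw1)
    _ = _ := by ring

theorem exists_norm_one_le_log (h : IsMeanDirichletSeries L) :
    ∃ C : ℝ, ∀ t : ℝ, 1 ≤ |t| → ‖L (1 + t * I)‖ ≤ C * (1 + Real.log |t|) := by
  obtain ⟨c, κ, b, B, hb, hc, hB, hd, hL⟩ := h
  have hB0 : 0 ≤ B := (norm_nonneg _).trans (hB 0)
  refine ⟨1 / b + 2 + (‖κ‖ + (‖κ‖ + 2 * B) * 2), fun t ht => ?_⟩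
  set M : ℕ := ⌈|t|⌉₊ with hM
  have hMt : |t| ≤ M := Nat.le_ceil _
  have hM2 : (M : ℝ) ≤ 2 * |t| := by linarith [Nat.ceil_lt_add_one (abs_nonneg t)]
  have hlog : 0 ≤ Real.log |t| := Real.log_nonneg ht
  have hlogM : 1 + Real.log M ≤ 2 * (1 + Real.log |t|) := by
    have := one_add_mul_log_le zero_le_one ht (by linarith) hM2
    simp only [one_mul] at this
    linarith
  set N : ℕ := M + 1 with hN
  set S : ℂ → ℂ := fun s => ∑ n ∈ range N, c n * ((n + b : ℝ) : ℂ) ^ (-s) with hS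
  have hb' : 1 + |t| ≤ b + N := by
    rw [hN]
    push_cast
    linarith
  have hB' : ∀ n, ‖∑ m ∈ range n, (c (N + m) - κ)‖ ≤ 2 * B := fun n => by
    have h := sum_range_add (fun m => c m - κ) N n
    rw [← sub_eq_iff_eq_add'] at h
    rw [← h]
    linarith [norm_sub_le (∑ m ∈ range (N + n), (c m - κ)) (∑ m ∈ range N, (c m - κ)),
      hB (N + n), hB N]
  have hd' : ∀ s : ℂ, s ≠ 1 → DifferentiableAt ℂ (fun s => L s - S s) s := fun s hs => by
    refine (hd s hs).sub (DifferentiableAt.fun_sum fun n _ => ?_)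
    have hnb : ((n + b : ℝ) : ℂ) ≠ 0 := by
      rw [Complex.ofReal_ne_zero]
      positivity
    exact (differentiableAt_id.neg.const_cpow (Or.inl hnb)).const_mul _
  have hL' : ∀ s : ℂ, 1 < s.re →
      HasSum (fun n : ℕ => c (N + n) * ((n + (b + N) : ℝ) : ℂ) ^ (-s)) (L s - S s) := fun s hs => by
    refine ((hasSum_nat_add_iff' N).2 (hL s hs)).congr_fun fun n => ?_
    rw [add_comm n N]
    push_cast
    ring_nf
  have hre : (1 + t * I : ℂ).re = 1 := by simp
  have him : (1 + t * I : ℂ).im = t := by simp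
  have ht0 : t ≠ 0 := by
    rintro rfl
    norm_num at ht
  have hmain := norm_le_of_hasSum_of_re_pos (by positivity) hB' hd' hL' (w := 1 + t * I)
    (by simp) (by simpa using ht0)
  rw [hre, him, sub_self, Real.rpow_zero] at hmain
  have hfin : ‖S (1 + t * I)‖ ≤ 1 / b + 2 * (1 + Real.log |t|) := by
    refine (norm_sum_le _ _).trans (le_trans (sum_le_sum fun n _ => ?_)
      ((sum_range_one_div_add_le hb M).trans (by linarith)))
    have hnb : 0 < n + b := by positivity
    rw [norm_mul, Complex.norm_cpow_eq_rpow_re_of_pos hnb, neg_re, hre, Real.rpow_neg_one, one_div]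
    exact mul_le_of_le_one_left (by positivity) (hc n)
  have htail : (‖κ‖ + 2 * B) * ‖(1 + t * I : ℂ)‖ * ∑' n : ℕ, (n + (b + N)) ^ (-1 - 1 : ℝ) ≤
      (‖κ‖ + 2 * B) * 2 := by
    rw [mul_assoc]
    refine mul_le_mul_of_nonneg_left ?_ (by positivity)
    have hn : ‖(1 + t * I : ℂ)‖ ≤ 2 * |t| := by
      refine (norm_add_le _ _).trans ?_
      simp
      linarith
    have hs : ∑' n : ℕ, (n + (b + N)) ^ (-1 - 1 : ℝ) ≤ 1 / |t| :=
      (tsum_nat_add_rpow_le (by linarith)).trans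
        (one_div_le_one_div_of_le (by linarith) (by linarith))
    calc _ ≤ 2 * |t| * (1 / |t|) :=
          mul_le_mul hn hs (tsum_nonneg fun n => by positivity) (by positivity)
      _ = 2 := by field_simp
  have hpole : ‖κ‖ * (1 / |t|) ≤ ‖κ‖ :=
    mul_le_of_le_one_right (norm_nonneg κ) (div_le_one_of_le₀ ht (abs_nonneg t))
  have hLS : ‖L (1 + t * I)‖ ≤ 1 / b + 2 * (1 + Real.log |t|) + (‖κ‖ + (‖κ‖ + 2 * B) * 2) := by
    have := norm_add_le (L (1 + t * I) - S (1 + t * I)) (S (1 + t * I))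
    rw [sub_add_cancel] at this
    refine this.trans ((add_le_add (hmain.trans (add_le_add hpole htail)) hfin).trans (le_of_eq ?_))
    ring
  refine hLS.trans ?_
  have h1 : 0 ≤ (1 / b + (‖κ‖ + (‖κ‖ + 2 * B) * 2)) * Real.log |t| := by positivity
  linarith

theorem exists_norm_le_log (h : IsMeanDirichletSeries L) {σ : ℝ} (hσ : 1 ≤ σ) :
    ∃ C : ℝ, ∀ t : ℝ, 1 ≤ |t| → ‖L (σ + t * I)‖ ≤ C * (1 + Real.log |t|) := by
  rcases hσ.eq_or_lt with rfl | hσ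
  · simpa using h.exists_norm_one_le_log
  · obtain ⟨C, hC⟩ := h.exists_norm_le_of_one_lt hσ
    refine ⟨C, fun t ht => (hC t).trans (le_mul_of_one_le_right ?_ ?_)⟩
    · exact (norm_nonneg _).trans (hC t)
    · linarith [Real.log_nonneg ht]

end IsMeanDirichletSeries

theorem isMeanDirichletSeries_hurwitzZeta {a : ℝ} (ha : 0 < a) (ha1 : a ≤ 1) :
    IsMeanDirichletSeries (HurwitzZeta.hurwitzZeta (a : UnitAddCircle)) := by
  refine ⟨fun _ => 1, 1, a, 0, ha, by simp, by simp, fun s hs =>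
    HurwitzZeta.differentiableAt_hurwitzZeta _ hs, fun s hs => ?_⟩
  refine (HurwitzZeta.hasSum_hurwitzZeta_of_one_lt_re ⟨ha.le, ha1⟩ hs).congr_fun fun n => ?_
  push_cast
  rw [one_mul, Complex.cpow_neg, one_div]

theorem isMeanDirichletSeries_expZeta (x : UnitAddCircle) :
    IsMeanDirichletSeries (HurwitzZeta.expZeta x) := by
  induction x using QuotientAddGroup.induction_on with | H r => ?_
  set q : ℂ := cexp (2 * π * I * r) with hq
  have hq1 : ‖q‖ = 1 := by
    rw [hq, show (2 * π * I * r : ℂ) = ((2 * π * r : ℝ) : ℂ) * I by push_cast; ring,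
      Complex.norm_exp_ofReal_mul_I]
  have hsum : ∀ s : ℂ, 1 < s.re → HasSum (fun n : ℕ => q ^ (n + 1) * ((n + 1 : ℝ) : ℂ) ^ (-s))
      (HurwitzZeta.expZeta (r : UnitAddCircle) s) := by
    intro s hs
    have hs0 : s ≠ 0 := by
      rintro rfl
      norm_num at hs
    have h := (hasSum_nat_add_iff' 1).2 (HurwitzZeta.hasSum_expZeta_of_one_lt_re r hs)
    simp only [range_one, sum_singleton, Nat.cast_zero, Complex.zero_cpow hs0, div_zero,
      sub_zero] at h
    refine h.congr_fun fun n => ?_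
    rw [hq, ← Complex.exp_nat_mul, Complex.cpow_neg, ← div_eq_mul_inv]
    push_cast
    ring_nf
  have hd : ∀ s : ℂ, s ≠ 1 → DifferentiableAt ℂ (HurwitzZeta.expZeta (r : UnitAddCircle)) s :=
    fun s hs => HurwitzZeta.differentiableAt_expZeta _ s (Or.inl hs)
  have hc : ∀ n : ℕ, ‖q ^ (n + 1)‖ ≤ 1 := fun n => by rw [norm_pow, hq1, one_pow]
  by_cases h1 : q = 1
  · exact ⟨fun n => q ^ (n + 1), 1, 1, 0, one_pos, hc, by simp [h1], hd, hsum⟩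
  · refine ⟨fun n => q ^ (n + 1), 0, 1, 2 / ‖q - 1‖, one_pos, hc, fun n => ?_, hd, hsum⟩
    simp_rw [sub_zero, pow_succ]
    rw [← sum_mul, geom_sum_eq h1, norm_mul, hq1, mul_one, norm_div]
    gcongr
    refine (norm_sub_le _ _).trans ?_
    rw [norm_pow, hq1]
    norm_num

theorem norm_hurwitzZeta_le {a : UnitAddCircle} {x t : ℝ} (ht : 0 < t) :
    ‖HurwitzZeta.hurwitzZeta a (x + t * I)‖ ≤
      (2 * π) ^ (x - 1) * (‖Complex.Gamma ((1 - x : ℝ) + t * I)‖ * Real.exp (π * t / 2) *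
        (‖HurwitzZeta.expZeta a ((1 - x : ℝ) + (-t : ℝ) * I)‖ +
          ‖HurwitzZeta.expZeta (-a) ((1 - x : ℝ) + (-t : ℝ) * I)‖)) := by
  set w : ℂ := (1 - x : ℝ) + (-t : ℝ) * I with hw
  have hre : w.re = 1 - x := by simp [hw]
  have him : w.im = -t := by simp [hw]
  have h1 : ∀ n : ℕ, w ≠ -n := by
    intro n h
    have := congrArg Complex.im h
    simp only [him, neg_im, natCast_im, neg_zero] at this
    linarith
  have h2 : w ≠ 1 := by
    intro h
    have := congrArg Complex.im h
    simp only [him, one_im] at this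
    linarith
  have hs : (x + t * I : ℂ) = 1 - w := by
    rw [hw]
    push_cast
    ring
  have hconj : ((1 - x : ℝ) + t * I : ℂ) = (starRingEnd ℂ) w := by
    apply Complex.ext <;> simp [hre, him]
  rw [hs, HurwitzZeta.hurwitzZeta_one_sub a h1 (Or.inr h2), hconj, Complex.Gamma_conj,
    Complex.norm_conj, norm_mul, norm_mul]
  have hpow : ‖(2 * π : ℂ) ^ (-w)‖ = (2 * π) ^ (x - 1) := by
    rw [show (2 * π : ℂ) = ((2 * π : ℝ) : ℂ) by push_cast; rfl,
      Complex.norm_cpow_eq_rpow_re_of_pos (by positivity), neg_re, hre, neg_sub]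
  rw [hpow]
  have he1 : ‖cexp (-π * I * w / 2)‖ ≤ Real.exp (π * t / 2) := by
    rw [Complex.norm_exp, Real.exp_le_exp]
    have : (-π * I * w / 2 : ℂ).re = π * w.im / 2 := by
      rw [show (-π * I * w / 2 : ℂ) = ((-π / 2 : ℝ) : ℂ) * (I * w) by push_cast; ring,
        Complex.re_ofReal_mul, Complex.I_mul_re]
      ring
    rw [this, him]
    have : 0 < π * t := by positivity
    linarith
  have he2 : ‖cexp (π * I * w / 2)‖ ≤ Real.exp (π * t / 2) := by
    rw [Complex.norm_exp, Real.exp_le_exp]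
    have : (π * I * w / 2 : ℂ).re = -(π * w.im / 2) := by
      rw [show (π * I * w / 2 : ℂ) = ((π / 2 : ℝ) : ℂ) * (I * w) by push_cast; ring,
        Complex.re_ofReal_mul, Complex.I_mul_re]
      ring
    rw [this, him]
    linarith
  rw [mul_assoc ((2 * π) ^ (x - 1)), mul_assoc ‖Complex.Gamma w‖]
  gcongr
  rw [mul_add (Real.exp _)]
  refine (norm_add_le _ _).trans (add_le_add ?_ ?_)
  · rw [norm_mul]
    gcongr
  · rw [norm_mul]
    gcongr

theorem exists_norm_hurwitzZeta_le_of_nonpos (a : UnitAddCircle) {σ : ℝ} (hσ : σ ≤ 0) :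
    ∃ C : ℝ, ∀ t : ℝ, 1 ≤ t →
      ‖HurwitzZeta.hurwitzZeta a (σ + t * I)‖ ≤ C * t ^ (1 / 2 - σ) * (1 + Real.log t) := by
  obtain ⟨C, hC⟩ := exists_norm_Gamma_le (x := 1 - σ) (by linarith)
  obtain ⟨D, hD⟩ := (isMeanDirichletSeries_expZeta a).exists_norm_le_log (σ := 1 - σ)
    (by linarith)
  obtain ⟨E, hE⟩ := (isMeanDirichletSeries_expZeta (-a)).exists_norm_le_log (σ := 1 - σ)
    (by linarith)
  refine ⟨(2 * π) ^ (σ - 1) * (C * (D + E)), fun t ht => ?_⟩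
  have habs : |-t| = t := by rw [abs_neg, abs_of_pos (by linarith)]
  have hD' := hD (-t) (habs.symm ▸ ht)
  have hE' := hE (-t) (habs.symm ▸ ht)
  rw [habs] at hD' hE'
  refine (norm_hurwitzZeta_le (by linarith)).trans ?_
  have hG : ‖Complex.Gamma ((1 - σ : ℝ) + t * I)‖ * Real.exp (π * t / 2) ≤
      C * t ^ (1 / 2 - σ) := by
    calc _ ≤ C * t ^ (1 - σ - 1 / 2) * Real.exp (-(π * t / 2)) * Real.exp (π * t / 2) := by
          gcongr
          exact hC t ht
      _ = C * t ^ (1 / 2 - σ) := by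
          rw [mul_assoc, ← Real.exp_add, neg_add_cancel, Real.exp_zero, mul_one]
          ring_nf
  have hprod := mul_le_mul hG (add_le_add hD' hE')
    (add_nonneg (norm_nonneg _) (norm_nonneg _))
    ((mul_nonneg (norm_nonneg (Complex.Gamma _)) (Real.exp_pos _).le).trans hG)
  calc _ ≤ (2 * π) ^ (σ - 1) * (C * t ^ (1 / 2 - σ) *
        (D * (1 + Real.log t) + E * (1 + Real.log t))) := by gcongr
    _ = _ := by ring

theorem exists_norm_hurwitzZeta_le_exp {a : ℝ} (ha : 0 < a) (ha1 : a ≤ 1) :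
    ∃ C : ℝ, ∀ x ∈ Set.Icc (0 : ℝ) 1, ∀ t : ℝ, 1 ≤ t →
      ‖HurwitzZeta.hurwitzZeta (a : UnitAddCircle) (x + t * I)‖ ≤
        C * Real.exp ((π / 2 + 1) * t) := by
  obtain ⟨C, hC0, hC⟩ := (isMeanDirichletSeries_hurwitzZeta ha ha1).exists_norm_le_mul_norm
  obtain ⟨D, hD0, hD⟩ :=
    (isMeanDirichletSeries_expZeta (a : UnitAddCircle)).exists_norm_le_mul_norm
  obtain ⟨E, hE0, hE⟩ :=
    (isMeanDirichletSeries_expZeta (-(a : UnitAddCircle))).exists_norm_le_mul_norm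
  obtain ⟨G, hG⟩ : ∃ G : ℝ, ∀ y ∈ Set.Icc (1 / 2 : ℝ) 1, ‖Real.Gamma y‖ ≤ G := by
    refine isCompact_Icc.exists_bound_of_continuousOn fun y hy => ?_
    refine (Real.differentiableAt_Gamma fun m => ?_).continuousAt.continuousWithinAt
    have := hy.1
    have : (0 : ℝ) ≤ m := Nat.cast_nonneg m
    intro h
    linarith
  have hG0 : 0 ≤ G := (norm_nonneg _).trans (hG 1 (by norm_num))
  have hnorm : ∀ x ∈ Set.Icc (0 : ℝ) 1, ∀ t : ℝ, ‖(x + t * I : ℂ)‖ ≤ Real.exp |t| := by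
    intro x hx t
    refine (norm_add_le _ _).trans ?_
    rw [norm_mul, Complex.norm_real, Complex.norm_real, Complex.norm_I, Real.norm_eq_abs,
      Real.norm_eq_abs, abs_of_nonneg hx.1]
    linarith [Real.add_one_le_exp |t|, hx.2]
  refine ⟨C + G * (D + E), fun x hx t ht => ?_⟩
  have hπ : Real.exp ((π / 2 + 1) * t) = Real.exp (π * t / 2) * Real.exp t := by
    rw [← Real.exp_add]
    ring_nf
  have hGDE : 0 ≤ G * (D + E) := by positivity
  have htabs : |t| = t := abs_of_pos (by linarith)
  have htabs' : |-t| = t := by rw [abs_neg, htabs]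
  rw [hπ]
  rcases le_total (1 / 2) x with hx2 | hx2
  · have h := hC (x + t * I) (by simpa using hx2) (by simpa using hx.2) (by simpa [htabs] using ht)
    have hn := hnorm x hx t
    rw [htabs] at hn
    have h1 : 1 ≤ Real.exp (π * t / 2) := Real.one_le_exp (by positivity)
    calc _ ≤ C * Real.exp t := h.trans (by gcongr)
      _ ≤ (C + G * (D + E)) * (Real.exp (π * t / 2) * Real.exp t) := by
          gcongr
          · linarith
          · exact le_mul_of_one_le_left (Real.exp_pos t).le h1
  · have hx' : 1 - x ∈ Set.Icc (0 : ℝ) 1 := ⟨by linarith [hx.2], by linarith [hx.1]⟩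
    have hn := hnorm (1 - x) hx' (-t)
    rw [htabs'] at hn
    have hre : ((1 - x : ℝ) + (-t : ℝ) * I : ℂ).re = 1 - x := by simp
    have him : ((1 - x : ℝ) + (-t : ℝ) * I : ℂ).im = -t := by simp
    have hw1 : 1 / 2 ≤ ((1 - x : ℝ) + (-t : ℝ) * I : ℂ).re := by
      rw [hre]
      linarith
    have hw2 : ((1 - x : ℝ) + (-t : ℝ) * I : ℂ).re ≤ 1 := hre.trans_le hx'.2
    have hw3 : 1 ≤ |((1 - x : ℝ) + (-t : ℝ) * I : ℂ).im| := by
      rwa [him, htabs']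
    have hGam : ‖Complex.Gamma ((1 - x : ℝ) + t * I)‖ ≤ G := by
      have hre' : ((1 - x : ℝ) + t * I : ℂ).re = 1 - x := by simp
      refine (norm_Gamma_le_Gamma_re (by rw [hre']; linarith)).trans ?_
      rw [hre']
      exact (Real.le_norm_self _).trans (hG _ ⟨by linarith, hx'.2⟩)
    have hpow : (2 * π) ^ (x - 1) ≤ 1 :=
      Real.rpow_le_one_of_one_le_of_nonpos (by linarith [Real.pi_gt_three]) (by linarith [hx.2])
    refine (norm_hurwitzZeta_le (by linarith)).trans
      ((mul_le_of_le_one_left (by positivity) hpow).trans ?_)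
    calc _ ≤ G * Real.exp (π * t / 2) * (D * Real.exp t + E * Real.exp t) := by
          gcongr
          · exact (hD _ hw1 hw2 hw3).trans (by gcongr)
          · exact (hE _ hw1 hw2 hw3).trans (by gcongr)
      _ = G * (D + E) * (Real.exp (π * t / 2) * Real.exp t) := by ring
      _ ≤ _ := by
          gcongr
          linarith

theorem exists_norm_hurwitzZeta_le_of_mem_Icc {a : ℝ} (ha : 0 < a) (ha1 : a ≤ 1) :
    ∃ C : ℝ, ∀ x ∈ Set.Icc (0 : ℝ) 1, ∀ t : ℝ, 2 ≤ t →
      ‖HurwitzZeta.hurwitzZeta (a : UnitAddCircle) (x + t * I)‖ ≤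
        C * t ^ ((1 - x) / 2) * (1 + Real.log t) := by
  obtain ⟨C, hC⟩ := exists_norm_le_interpolate (α := 0) (A := 1 / 2) (B := 0) (κ := 1)
    (K := π / 2 + 1) (t₀ := 1) (f := HurwitzZeta.hurwitzZeta (a : UnitAddCircle)) zero_le_one
    le_rfl (by positivity) (by norm_num)
    (fun s hs => HurwitzZeta.differentiableAt_hurwitzZeta _ (by rintro rfl; simp at hs))
    (by
      simpa using exists_norm_hurwitzZeta_le_of_nonpos (a : UnitAddCircle) (le_refl (0 : ℝ)))
    (by
      obtain ⟨C, hC⟩ := (isMeanDirichletSeries_hurwitzZeta ha ha1).exists_norm_le_log le_rfl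
      refine ⟨C, fun t ht => ?_⟩
      have h := hC t (ht.trans (le_abs_self t))
      rw [abs_of_pos (by linarith)] at h
      simpa using h)
    (by simpa using exists_norm_hurwitzZeta_le_exp ha ha1)
  refine ⟨C, fun x hx t ht => ?_⟩
  have h := hC x (by simpa using hx) t (by linarith)
  rwa [one_mul, show 1 / 2 + (0 - 1 / 2) * (x - 0) = (1 - x) / 2 by ring] at h

theorem exists_pos_forall_le_mul_log {f : ℝ → ℝ} {C p : ℝ}
    (h : ∀ t : ℝ, 2 ≤ t → f t ≤ C * t ^ p * (1 + Real.log t)) :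
    ∃ D > (0 : ℝ), ∀ t : ℝ, 2 ≤ t → f t ≤ D * t ^ p * Real.log t := by
  have hlog2 : 0 < Real.log 2 := Real.log_pos one_lt_two
  refine ⟨(|C| + 1) * (1 / Real.log 2 + 1), by positivity, fun t ht => (h t ht).trans ?_⟩
  have hlog : Real.log 2 ≤ Real.log t := Real.log_le_log two_pos ht
  have h1 : 1 + Real.log t ≤ (1 / Real.log 2 + 1) * Real.log t := by
    have : 1 ≤ 1 / Real.log 2 * Real.log t := by
      rwa [one_div_mul_eq_div, one_le_div hlog2]
    linarith
  calc C * t ^ p * (1 + Real.log t)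
      ≤ (|C| + 1) * t ^ p * ((1 / Real.log 2 + 1) * Real.log t) := by
        gcongr
        · linarith
        · linarith [le_abs_self C]
    _ = _ := by ring

theorem stmt17 (a : ℝ) (ha : 0 < a) (ha1 : a ≤ 1) (σ : ℝ) :
    (1 < σ → ∃ C > (0 : ℝ), ∀ t : ℝ, 2 ≤ t → ‖hzeta a (σ + t * I)‖ ≤ C) ∧
    (0 ≤ σ → σ ≤ 1 →
      ∃ C > (0 : ℝ), ∀ t : ℝ, 2 ≤ t →
        ‖hzeta a (σ + t * I)‖ ≤ C * t ^ ((1 - σ) / 2) * Real.log t) ∧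
    (σ ≤ 0 →
      ∃ C > (0 : ℝ), ∀ t : ℝ, 2 ≤ t →
        ‖hzeta a (σ + t * I)‖ ≤ C * t ^ (1 / 2 - σ) * Real.log t) := by
  refine ⟨fun hσ => ?_, fun h0 h1 => ?_, fun hσ => ?_⟩
  · obtain ⟨C, hC⟩ := (isMeanDirichletSeries_hurwitzZeta ha ha1).exists_norm_le_of_one_lt hσ
    exact ⟨|C| + 1, by positivity, fun t _ => (hC t).trans (by linarith [le_abs_self C])⟩
  · obtain ⟨C, hC⟩ := exists_norm_hurwitzZeta_le_of_mem_Icc ha ha1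
    exact exists_pos_forall_le_mul_log (hC σ ⟨h0, h1⟩)
  · obtain ⟨C, hC⟩ := exists_norm_hurwitzZeta_le_of_nonpos (a : UnitAddCircle) hσ
    exact exists_pos_forall_le_mul_log fun t ht => hC t (by linarith)
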